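/- Let n ≥ 2 be a natural number. For positive reals u₁, …, u_{n-1}, define arctanₙ(u₁,…,u_{n-1}) = ∫₀^{u₁} ⋯ ∫₀^{u_{n-1}} 1/(1 + x₁ⁿ + ⋯ + x_{n-1}ⁿ) dx₁⋯dx_{n-1}. Then for every real u > 0, arctanₙ(1/u, 1/u, …, 1/u) + (n-1) · arctanₙ(u, 1, …, 1) = n · ((1/n) · Γ(1/n))ⁿ. -/

import Mathlib

open MeasureTheory

/-- The `n`-th order arctan: the Lebesgue integral of
`x ↦ 1/(1 + x₁ⁿ + ⋯ + x_{n-1}ⁿ)` over the box `[0,u₁] × ⋯ × [0,u_{n-1}]`. -/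
noncomputable def arctanN (n : ℕ) (u : Fin (n - 1) → ℝ) : ℝ :=
  ∫ x in Set.univ.pi (fun i => Set.Icc (0:ℝ) (u i)),
    1 / (1 + ∑ i, x i ^ n)

/-- Primitive of `x ↦ exp (-xⁿ)` vanishing at `0`. -/
noncomputable def expNegPowPrimitive (n : ℕ) (t : ℝ) : ℝ :=
  ∫ s in (0:ℝ)..t, Real.exp (-s ^ n)

lemma hasDerivAt_expNegPowPrimitive (n : ℕ) (t : ℝ) :
    HasDerivAt (expNegPowPrimitive n) (Real.exp (-t ^ n)) t :=
  (show Continuous fun s : ℝ => Real.exp (-s ^ n) by fun_prop).integral_hasStrictDerivAt 0 t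
    |>.hasDerivAt

lemma integrableOn_pow_mul_exp_neg_pow (k : ℕ) {n : ℕ} (hn : 0 < n) :
    IntegrableOn (fun t : ℝ => t ^ k * Real.exp (-t ^ n)) (Set.Ioi 0) := by
  have hk : (-1 : ℝ) < k := by have : (0 : ℝ) ≤ k := k.cast_nonneg; linarith
  simpa only [Real.rpow_natCast] using
    integrableOn_rpow_mul_exp_neg_rpow hk (Nat.cast_pos.mpr hn)

lemma integral_pow_mul_exp_neg_mul_pow {n : ℕ} (hn : 0 < n) {b : ℝ} (hb : 0 < b) :
    ∫ t in Set.Ioi (0 : ℝ), t ^ (n - 1) * Real.exp (-b * t ^ n) = 1 / (n * b) := by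
  have hn' : (0 : ℝ) < n := Nat.cast_pos.mpr hn
  have hk : (-1 : ℝ) < (n - 1 : ℕ) := by
    have : (0 : ℝ) ≤ (n - 1 : ℕ) := Nat.cast_nonneg _
    linarith
  have h := integral_rpow_mul_exp_neg_mul_rpow hn' hk hb
  have hc : ((n - 1 : ℕ) : ℝ) + 1 = n := by exact_mod_cast Nat.sub_add_cancel hn
  simp only [Real.rpow_natCast, hc, neg_div, div_self hn'.ne', Real.Gamma_one, Real.rpow_neg_one]
    at h
  rw [h]
  field_simp

lemma tendsto_expNegPowPrimitive {n : ℕ} (hn : 0 < n) :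
    Filter.Tendsto (expNegPowPrimitive n) Filter.atTop
      (nhds (1 / n * Real.Gamma (1 / n))) := by
  have hn' : (0 : ℝ) < n := Nat.cast_pos.mpr hn
  have h := integral_exp_neg_rpow hn'
  simp only [Real.rpow_natCast] at h
  rw [Real.Gamma_add_one (one_div_pos.mpr hn').ne'] at h
  rw [← h]
  refine intervalIntegral_tendsto_integral_Ioi 0 ?_ Filter.tendsto_id
  simpa using integrableOn_pow_mul_exp_neg_pow 0 hn

lemma expNegPowPrimitive_mul (n : ℕ) (u t : ℝ) (hu : 0 ≤ u) :
    expNegPowPrimitive n (u * t) =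
      t * ∫ x in Set.Icc 0 u, Real.exp (-(t * x) ^ n) := by
  rw [integral_Icc_eq_integral_Ioc, ← intervalIntegral.integral_of_le hu,
    intervalIntegral.mul_integral_comp_mul_left (f := fun s => Real.exp (-s ^ n)), mul_zero,
    mul_comm t u, expNegPowPrimitive]

lemma integral_box_exp_neg_mul (n : ℕ) (u : Fin (n - 1) → ℝ) (hu : ∀ i, 0 ≤ u i) (t : ℝ) :
    ∫ x in Set.univ.pi (fun i => Set.Icc (0 : ℝ) (u i)),
      t ^ (n - 1) * Real.exp (-(1 + ∑ i, x i ^ n) * t ^ n) =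
      Real.exp (-t ^ n) * ∏ i, expNegPowPrimitive n (u i * t) := by
  have h (x : Fin (n - 1) → ℝ) : t ^ (n - 1) * Real.exp (-(1 + ∑ i, x i ^ n) * t ^ n) =
      Real.exp (-t ^ n) * t ^ (n - 1) * ∏ i, Real.exp (-(t * x i) ^ n) := by
    have he : -(1 + ∑ i, x i ^ n) * t ^ n = -t ^ n + ∑ i, -(t * x i) ^ n := by
      simp only [mul_pow, Finset.sum_neg_distrib, ← Finset.mul_sum]
      ring
    rw [he, Real.exp_add, Real.exp_sum]
    ring
  simp_rw [h, expNegPowPrimitive_mul n _ t (hu _)]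
  rw [integral_const_mul, volume_pi, Measure.restrict_pi_pi,
    integral_fintype_prod_eq_prod (fun _ (y : ℝ) => Real.exp (-(t * y) ^ n)),
    Finset.prod_mul_distrib]
  simp [mul_assoc]

lemma integrable_box_prod_Ioi {n : ℕ} (hn : 0 < n) (u : Fin (n - 1) → ℝ) :
    Integrable (Function.uncurry fun (x : Fin (n - 1) → ℝ) (t : ℝ) =>
        t ^ (n - 1) * Real.exp (-(1 + ∑ i, x i ^ n) * t ^ n))
      ((volume.restrict (Set.univ.pi fun i => Set.Icc (0 : ℝ) (u i))).prod
        (volume.restrict (Set.Ioi 0))) := by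
  have hfin : IsFiniteMeasure
      ((volume : Measure (Fin (n - 1) → ℝ)).restrict
        (Set.univ.pi fun i => Set.Icc (0 : ℝ) (u i))) :=
    isFiniteMeasure_restrict.mpr
      (isCompact_univ_pi fun i => isCompact_Icc (a := (0 : ℝ)) (b := u i)).measure_lt_top.ne
  refine ((integrableOn_pow_mul_exp_neg_pow (n - 1) hn).integrable.comp_snd _).mono
    (Continuous.aestronglyMeasurable (by unfold Function.uncurry; fun_prop)) ?_
  rw [Measure.prod_restrict]
  refine (ae_restrict_iff' ((MeasurableSet.univ_pi fun i => measurableSet_Icc).prod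
    measurableSet_Ioi)).mpr (Filter.Eventually.of_forall ?_)
  rintro ⟨x, t⟩ ⟨hx, ht⟩
  have ht' : 0 < t := ht
  have hs : 0 ≤ ∑ i, x i ^ n :=
    Finset.sum_nonneg fun i _ => pow_nonneg (hx i (Set.mem_univ i)).1 n
  simp only [Function.uncurry_apply_pair, norm_mul, Real.norm_eq_abs, Real.abs_exp]
  gcongr
  nlinarith [mul_nonneg hs (pow_pos ht' n).le]

/-- The one-dimensional integrand representing `arctanN n u` is integrable. -/
lemma integrableOn_exp_mul_prod_primitive {n : ℕ} (hn : 0 < n) (u : Fin (n - 1) → ℝ)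
    (hu : ∀ i, 0 ≤ u i) :
    IntegrableOn (fun t => Real.exp (-t ^ n) * ∏ i, expNegPowPrimitive n (u i * t))
      (Set.Ioi 0) := by
  have h := (integrable_box_prod_Ioi hn u).integral_prod_right
  simp only [Function.uncurry_apply_pair, integral_box_exp_neg_mul n u hu] at h
  exact h

lemma arctanN_eq_integral {n : ℕ} (hn : 0 < n) (u : Fin (n - 1) → ℝ) (hu : ∀ i, 0 ≤ u i) :
    arctanN n u =
      n * ∫ t in Set.Ioi (0 : ℝ), Real.exp (-t ^ n) * ∏ i, expNegPowPrimitive n (u i * t) := by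
  have hn' : (n : ℝ) ≠ 0 := Nat.cast_ne_zero.mpr hn.ne'
  simp_rw [← integral_box_exp_neg_mul n u hu]
  rw [← integral_integral_swap (integrable_box_prod_Ioi hn u), ← integral_const_mul, arctanN]
  refine setIntegral_congr_fun (MeasurableSet.univ_pi fun i => measurableSet_Icc) fun x hx => ?_
  have hs : 0 ≤ ∑ i, x i ^ n :=
    Finset.sum_nonneg fun i _ => pow_nonneg (hx i (Set.mem_univ i)).1 n
  have hpos : 0 < 1 + ∑ i, x i ^ n := by linarith
  simp only [integral_pow_mul_exp_neg_mul_pow hn hpos]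
  field_simp

/-- For `n ≥ 2` and `u > 0`,
`arctanₙ(1/u,…,1/u) + (n-1)·arctanₙ(u,1,…,1) = n · ((1/n)·Γ(1/n))ⁿ`. -/
theorem arctanN_inv_diag_add (n : ℕ) (hn : 2 ≤ n) (u : ℝ) (hu : 0 < u) :
    arctanN n (fun _ => 1 / u)
      + ((n : ℝ) - 1) * arctanN n (fun q => if q.val = 0 then u else 1)
      = n * ((1 / n) * Real.Gamma (1 / n)) ^ n := by
  obtain ⟨k, rfl⟩ : ∃ k, n = k + 2 := ⟨n - 2, by omega⟩
  set n := k + 2 with hk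
  have hn0 : 0 < n := by omega
  set F := expNegPowPrimitive n with hF
  have hu0 : ∀ i : Fin (n - 1), (0 : ℝ) ≤ (fun _ => 1 / u) i := fun _ => by positivity
  have hv0 : ∀ i : Fin (n - 1), (0 : ℝ) ≤ (fun q : Fin (n - 1) => if q.val = 0 then u else 1) i :=
    fun i => by dsimp only; split_ifs <;> linarith
  have hA := arctanN_eq_integral hn0 _ hu0
  have hB := arctanN_eq_integral hn0 _ hv0
  have iA := integrableOn_exp_mul_prod_primitive hn0 _ hu0
  have iB := integrableOn_exp_mul_prod_primitive hn0 _ hv0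
  have eA (t : ℝ) : ∏ _i : Fin (n - 1), F (1 / u * t) = F (1 / u * t) ^ (k + 1) := by
    simp [hk]
  have eB (t : ℝ) : ∏ i : Fin (n - 1), F ((if i.val = 0 then u else 1) * t) =
      F (u * t) * F t ^ k := by
    change ∏ i : Fin (k + 1), F ((if i.val = 0 then u else 1) * t) = _
    simp [Fin.prod_univ_succ]
  simp only [← hF, eA] at hA iA
  simp only [← hF, eB] at hB iB
  set g : ℝ → ℝ := fun t => Real.exp (-t ^ n) * F (1 / u * t) ^ (k + 1) with hg
  have eg (s : ℝ) : g (u * s) = Real.exp (-(u * s) ^ n) * F s ^ (k + 1) := by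
    simp only [hg]
    rw [← mul_assoc, one_div_mul_cancel hu.ne', one_mul]
  have iA' : IntegrableOn (fun s => g (u * s)) (Set.Ioi 0) :=
    (integrableOn_Ioi_comp_mul_left_iff g 0 hu).mpr (by rwa [mul_zero])
  have hA' : ∫ t in Set.Ioi 0, g t = ∫ s in Set.Ioi 0, u * g (u * s) := by
    have h := integral_comp_mul_left_Ioi' g 0 hu
    rw [mul_zero] at h
    rw [integral_const_mul, ← h, smul_eq_mul]
  have hderiv (t : ℝ) : HasDerivAt (fun t => F (u * t) * F t ^ (k + 1))
      (u * g (u * t) + (k + 1) * (Real.exp (-t ^ n) * (F (u * t) * F t ^ k))) t := by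
    have h1 : HasDerivAt (fun t => F (u * t)) (Real.exp (-(u * t) ^ n) * (u * 1)) t :=
      (hasDerivAt_expNegPowPrimitive n (u * t)).comp t ((hasDerivAt_id t).const_mul u)
    refine (h1.mul ((hasDerivAt_expNegPowPrimitive n t).pow (k + 1))).congr_deriv ?_
    rw [eg]
    simp only [← hF, Nat.add_sub_cancel, Nat.cast_add, Nat.cast_one, Pi.pow_apply]
    ring
  have hlim := tendsto_expNegPowPrimitive hn0
  have hlim' := (hlim.comp (Filter.tendsto_id.const_mul_atTop hu)).mul (hlim.pow (k + 1))
  have hI := integral_Ioi_of_hasDerivAt_of_tendsto' (a := 0) (fun t _ => hderiv t)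
    ((iA'.const_mul u).add (iB.const_mul _)) hlim'
  have hF0 : F 0 = 0 := by simp [hF, expNegPowPrimitive]
  rw [integral_add (iA'.const_mul u) (iB.const_mul _), ← hA', integral_const_mul, mul_zero, hF0,
    zero_mul, sub_zero, ← pow_succ'] at hI
  have hnk : (n : ℝ) - 1 = k + 1 := by
    rw [hk]
    push_cast
    ring
  rw [hA, hB, hnk, ← hI]
  ring
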